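/- Let $\vartheta \geq 2$ be an integer, $m \geq 1$, $a_1, \ldots, a_m \in \mathbb{Z}$, and let $\ell, r$ be distinct primes with $\gcd(\ell r, a_1 \cdots a_m \vartheta) = 1$, $\gcd(\tau_\ell(\vartheta), \tau_r(\vartheta)) = 1$, and both $\tau_\ell(\vartheta)$ and $\tau_r(\vartheta)$ odd. Then for any integers $L_1, \ldots, L_m \geq 1$, with $L = \max_i L_i$ and $t = \tau_{\ell r}(\vartheta)$: $\sum_{k_1=1}^{L_1} \cdots \sum_{k_m=1}^{L_m} \left(\frac{a_1 \vartheta^{k_1} + \cdots + a_m \vartheta^{k_m}}{\ell r}\right) \ll L_1 \cdots L_m \, t^{-m+1} (\ell r)^{(m-1)/2} + (L^{m-1} t^{-m+1} + 1)(\ell r)^{(m+1)/2}(\log(\ell r))^m$, with an absolute implied constant. -/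

import Mathlib

open Finset

lemma addChar_map_sum {R ι : Type*} [CommRing R] (ψ : AddChar R ℂ) (s : Finset ι) (f : ι → R) :
    ψ (∑ i ∈ s, f i) = ∏ i ∈ s, ψ (f i) := by
  classical
  induction s using Finset.induction_on with
  | empty => simp
  | insert i s hi ih => rw [Finset.sum_insert hi, Finset.prod_insert hi, AddChar.map_add_eq_mul, ih]

lemma e_shift {R : Type*} [CommRing R] (ψ : AddChar R ℂ) (u : R) (t : ℕ) (hu : u ^ t = 1)
    (z : ℂ) (hz : z ^ t = 1) (c : R) :
    z * (∑ j ∈ range t, ψ (c * u * u ^ j) * z ^ j) = ∑ j ∈ range t, ψ (c * u ^ j) * z ^ j := by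
  have h1 := Finset.sum_range_succ (fun j => ψ (c * u ^ j) * z ^ j) t
  have h2 := Finset.sum_range_succ' (fun j => ψ (c * u ^ j) * z ^ j) t
  rw [h1] at h2
  simp only [hu, hz, pow_zero] at h2
  have h3 := add_right_cancel h2
  rw [h3, Finset.mul_sum]
  refine Finset.sum_congr rfl fun j _ => ?_
  rw [pow_succ', pow_succ', mul_assoc c u]
  ring

lemma e_shift_norm {R : Type*} [CommRing R] (ψ : AddChar R ℂ) (u : R) (t : ℕ) (hu : u ^ t = 1)
    (z : ℂ) (hz : z ^ t = 1) (hz1 : ‖z‖ = 1) (c : R) (i : ℕ) :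
    ‖∑ j ∈ range t, ψ (c * u ^ i * u ^ j) * z ^ j‖ = ‖∑ j ∈ range t, ψ (c * u ^ j) * z ^ j‖ := by
  induction i with
  | zero => simp
  | succ i ih =>
    rw [← ih, ← e_shift ψ u t hu z hz (c * u ^ i), norm_mul, hz1, one_mul, pow_succ, mul_assoc c]

lemma e_second {R : Type*} [CommRing R] [Fintype R] (ψ : AddChar R ℂ) (hψ : ψ.IsPrimitive)
    (u : R) (t : ℕ) (ht : t = orderOf u) (huu : IsUnit u) (z : ℂ) (hz1 : ‖z‖ = 1) :
    ∑ c : R, ‖∑ j ∈ range t, ψ (c * u ^ j) * z ^ j‖ ^ 2 = Fintype.card R * t := by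
  classical
  have key : ∀ c : R, ((‖∑ j ∈ range t, ψ (c * u ^ j) * z ^ j‖ ^ 2 : ℝ) : ℂ) =
      ∑ i ∈ range t, ∑ j ∈ range t, ψ (c * (u ^ i - u ^ j)) * (z ^ i * (starRingEnd ℂ) (z ^ j)) := by
    intro c
    rw [← Complex.normSq_eq_norm_sq, Complex.normSq_eq_conj_mul_self, mul_comm, map_sum,
      Finset.sum_mul_sum]
    refine Finset.sum_congr rfl fun i _ => Finset.sum_congr rfl fun j _ => ?_
    rw [map_mul (starRingEnd ℂ), mul_sub, sub_eq_add_neg, AddChar.map_add_eq_mul,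
      ← AddChar.map_neg_eq_conj]
    ring
  have : ((∑ c : R, ‖∑ j ∈ range t, ψ (c * u ^ j) * z ^ j‖ ^ 2 : ℝ) : ℂ) =
      ((Fintype.card R * t : ℝ) : ℂ) := by
    rw [Complex.ofReal_sum]
    simp_rw [key]
    rw [Finset.sum_comm]
    have : ∀ i ∈ range t, ∑ c : R, ∑ j ∈ range t,
        ψ (c * (u ^ i - u ^ j)) * (z ^ i * (starRingEnd ℂ) (z ^ j)) = Fintype.card R := by
      intro i hi
      rw [Finset.sum_comm]
      simp_rw [← Finset.sum_mul, AddChar.sum_mulShift _ hψ]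
      rw [Finset.sum_eq_single_of_mem i hi]
      · simp only [sub_self, if_true]
        rw [Complex.mul_conj, Complex.normSq_eq_norm_sq]
        simp [hz1]
      · intro j hj hji
        rw [if_neg]
        · simp
        · intro h
          apply hji
          have := (sub_eq_zero.mp h).symm
          subst ht
          exact pow_injOn_Iio_orderOf (by simpa using hj) (by simpa using hi) this
    rw [Finset.sum_congr rfl this]
    simp [mul_comm]
  exact_mod_cast this

lemma e_point {R : Type*} [CommRing R] [Fintype R] (ψ : AddChar R ℂ) (hψ : ψ.IsPrimitive)
    (u : R) (t : ℕ) (ht : t = orderOf u) (ht0 : 0 < t) (huu : IsUnit u) (z : ℂ) (hz : z ^ t = 1)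
    (hz1 : ‖z‖ = 1) (c : R) (hc : IsUnit c) :
    ‖∑ j ∈ range t, ψ (c * u ^ j) * z ^ j‖ ≤ √(Fintype.card R) := by
  classical
  have hu : u ^ t = 1 := ht ▸ pow_orderOf_eq_one u
  apply Real.le_sqrt_of_sq_le
  have h1 := e_second ψ hψ u t ht huu z hz1
  have h2 : ∑ c' ∈ (range t).image (fun i => c * u ^ i),
      ‖∑ j ∈ range t, ψ (c' * u ^ j) * z ^ j‖ ^ 2 ≤
      ∑ c : R, ‖∑ j ∈ range t, ψ (c * u ^ j) * z ^ j‖ ^ 2 :=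
    Finset.sum_le_sum_of_subset_of_nonneg (subset_univ _) (fun _ _ _ => by positivity)
  rw [Finset.sum_image] at h2
  · simp_rw [e_shift_norm ψ u t hu z hz hz1 c] at h2
    rw [h1] at h2
    simp only [sum_const, card_range, nsmul_eq_mul] at h2
    have : (0:ℝ) < t := by exact_mod_cast ht0
    nlinarith
  · intro i hi j hj hij
    subst ht
    exact pow_injOn_Iio_orderOf (by simpa using hi) (by simpa using hj) (hc.mul_left_cancel hij)

/-- Fourier expansion. -/
lemma fourier_exp {R : Type*} [CommRing R] (ψ : AddChar R ℂ) (u : R) (t : ℕ) (hu : u ^ t = 1)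
    (ht0 : 0 < t) (ζ : ℂ) (hζ : IsPrimitiveRoot ζ t) (c : R) (L : ℕ) :
    (t : ℂ) * ∑ k ∈ range L, ψ (c * u ^ k) =
      ∑ b ∈ range t, (∑ k ∈ range L, (ζ ^ b)⁻¹ ^ k) *
        (∑ j ∈ range t, ψ (c * u ^ j) * (ζ ^ b) ^ j) := by
  have hζ0 : ζ ≠ 0 := hζ.ne_zero ht0.ne'
  have horth : ∀ j ∈ range t, ∀ k : ℕ, ∑ b ∈ range t, (ζ ^ b)⁻¹ ^ k * (ζ ^ b) ^ j =
      if j = k % t then (t : ℂ) else 0 := by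
    intro j hj k
    have e : ∀ b : ℕ, (ζ ^ b)⁻¹ ^ k * (ζ ^ b) ^ j = (ζ ^ j * (ζ ^ k)⁻¹) ^ b := by
      intro b
      rw [mul_pow, inv_pow, inv_pow, ← pow_mul, ← pow_mul, ← pow_mul, ← pow_mul, mul_comm b k,
        mul_comm b j, mul_comm]
    simp_rw [e]
    have hk : ζ ^ k = ζ ^ (k % t) := by
      conv_lhs => rw [← Nat.div_add_mod k t, pow_add, pow_mul, hζ.pow_eq_one, one_pow, one_mul]
    split_ifs with h
    · rw [hk, ← h, mul_inv_cancel₀ (pow_ne_zero _ hζ0)]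
      simp
    · have hne : ζ ^ j * (ζ ^ k)⁻¹ ≠ 1 := by
        intro h1
        apply h
        rw [mul_inv_eq_one₀ (pow_ne_zero _ hζ0), hk] at h1
        exact hζ.pow_inj (by simpa using hj) (Nat.mod_lt _ ht0) h1
      rw [geom_sum_eq hne, mul_pow, inv_pow, ← pow_mul, ← pow_mul, mul_comm j, mul_comm k, pow_mul,
        pow_mul, hζ.pow_eq_one]
      simp
  have : ∀ k, (t : ℂ) * ψ (c * u ^ k) =
      ∑ b ∈ range t, (ζ ^ b)⁻¹ ^ k * (∑ j ∈ range t, ψ (c * u ^ j) * (ζ ^ b) ^ j) := by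
    intro k
    simp_rw [Finset.mul_sum]
    rw [Finset.sum_comm]
    have : ∀ j ∈ range t, ∑ b ∈ range t, (ζ ^ b)⁻¹ ^ k * (ψ (c * u ^ j) * (ζ ^ b) ^ j) =
        ψ (c * u ^ j) * (if j = k % t then (t : ℂ) else 0) := by
      intro j hj
      rw [← horth j hj k, Finset.mul_sum]
      exact Finset.sum_congr rfl fun b _ => by ring
    rw [Finset.sum_congr rfl this]
    have hk : u ^ k = u ^ (k % t) := by
      conv_lhs => rw [← Nat.div_add_mod k t, pow_add, pow_mul, hu, one_pow, one_mul]
    rw [Finset.sum_eq_single_of_mem (k % t) (by simpa using Nat.mod_lt _ ht0)]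
    · rw [hk]; simp [mul_comm]
    · intro j _ hj; simp [hj]
  rw [Finset.mul_sum]
  simp_rw [this, Finset.sum_mul]
  rw [Finset.sum_comm]

lemma incomplete {R : Type*} [CommRing R] [Fintype R] (ψ : AddChar R ℂ) (hψ : ψ.IsPrimitive)
    (u : R) (t : ℕ) (ht : t = orderOf u) (ht0 : 0 < t) (huu : IsUnit u)
    (ζ : ℂ) (hζ : IsPrimitiveRoot ζ t) (L : ℕ) (P : ℝ)
    (hP : ∑ b ∈ range t, ‖∑ k ∈ range L, (ζ ^ b)⁻¹ ^ k‖ ≤ t * P) :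
    (∀ c, IsUnit c → ‖∑ k ∈ range L, ψ (c * u ^ k)‖ ≤ √(Fintype.card R) * P) ∧
    ∑ c, ‖∑ k ∈ range L, ψ (c * u ^ k)‖ ^ 2 ≤ Fintype.card R * t * P ^ 2 := by
  have hu : u ^ t = 1 := ht ▸ pow_orderOf_eq_one u
  have ht1 : (0:ℝ) < t := by exact_mod_cast ht0
  have hζ1 : ‖ζ‖ = 1 := hζ.norm'_eq_one ht0.ne'
  have hb1 : ∀ b : ℕ, ‖ζ ^ b‖ = 1 := fun b => by simp [hζ1]
  have hbt : ∀ b : ℕ, (ζ ^ b) ^ t = 1 := fun b => by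
    rw [← pow_mul, mul_comm, pow_mul, hζ.pow_eq_one, one_pow]
  have hS0 : 0 ≤ ∑ b ∈ range t, ‖∑ k ∈ range L, (ζ ^ b)⁻¹ ^ k‖ :=
    Finset.sum_nonneg fun _ _ => norm_nonneg _
  have hF : ∀ c, t * ‖∑ k ∈ range L, ψ (c * u ^ k)‖ ≤
      ∑ b ∈ range t, ‖∑ k ∈ range L, (ζ ^ b)⁻¹ ^ k‖ *
        ‖∑ j ∈ range t, ψ (c * u ^ j) * (ζ ^ b) ^ j‖ := by
    intro c
    have := congrArg norm (fourier_exp ψ u t hu ht0 ζ hζ c L)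
    rw [norm_mul, Complex.norm_natCast] at this
    rw [this]
    refine (norm_sum_le _ _).trans (le_of_eq ?_)
    simp_rw [norm_mul]
  constructor
  · intro c hc
    have h : t * ‖∑ k ∈ range L, ψ (c * u ^ k)‖ ≤ t * (√(Fintype.card R) * P) := by
      refine (hF c).trans ?_
      calc _ ≤ ∑ b ∈ range t, ‖∑ k ∈ range L, (ζ ^ b)⁻¹ ^ k‖ * √(Fintype.card R) := by
            refine Finset.sum_le_sum fun b _ => ?_
            exact mul_le_mul_of_nonneg_left
              (e_point ψ hψ u t ht ht0 huu _ (hbt b) (hb1 b) c hc) (norm_nonneg _)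
        _ = (∑ b ∈ range t, ‖∑ k ∈ range L, (ζ ^ b)⁻¹ ^ k‖) * √(Fintype.card R) := by
            rw [Finset.sum_mul]
        _ ≤ (t * P) * √(Fintype.card R) := by gcongr
        _ = _ := by ring
    exact le_of_mul_le_mul_left h ht1
  · set S := ∑ b ∈ range t, ‖∑ k ∈ range L, (ζ ^ b)⁻¹ ^ k‖ with hS
    have h2 : ∀ c, (t * ‖∑ k ∈ range L, ψ (c * u ^ k)‖) ^ 2 ≤ S *
        ∑ b ∈ range t, ‖∑ k ∈ range L, (ζ ^ b)⁻¹ ^ k‖ *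
          ‖∑ j ∈ range t, ψ (c * u ^ j) * (ζ ^ b) ^ j‖ ^ 2 := by
      intro c
      refine (pow_le_pow_left₀ (by positivity) (hF c) 2).trans ?_
      apply Finset.sum_sq_le_sum_mul_sum_of_sq_le_mul
      · intros; positivity
      · intros; positivity
      · intros; apply le_of_eq; ring
    have h3 : (t:ℝ) ^ 2 * ∑ c, ‖∑ k ∈ range L, ψ (c * u ^ k)‖ ^ 2 ≤
        t ^ 2 * (Fintype.card R * t * P ^ 2) := by
      calc (t:ℝ) ^ 2 * ∑ c, ‖∑ k ∈ range L, ψ (c * u ^ k)‖ ^ 2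
          = ∑ c, (t * ‖∑ k ∈ range L, ψ (c * u ^ k)‖) ^ 2 := by
            rw [Finset.mul_sum]; simp_rw [mul_pow]
        _ ≤ ∑ c, S * ∑ b ∈ range t, ‖∑ k ∈ range L, (ζ ^ b)⁻¹ ^ k‖ *
          ‖∑ j ∈ range t, ψ (c * u ^ j) * (ζ ^ b) ^ j‖ ^ 2 := Finset.sum_le_sum fun c _ => h2 c
        _ = S * (S * (Fintype.card R * t)) := by
            rw [← Finset.mul_sum, Finset.sum_comm]
            simp_rw [← Finset.mul_sum]
            have : ∀ b ∈ range t, ‖∑ k ∈ range L, (ζ ^ b)⁻¹ ^ k‖ *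
              ∑ c, ‖∑ j ∈ range t, ψ (c * u ^ j) * (ζ ^ b) ^ j‖ ^ 2 =
              ‖∑ k ∈ range L, (ζ ^ b)⁻¹ ^ k‖ * (Fintype.card R * t) := fun b _ => by
                rw [e_second ψ hψ u t ht huu _ (hb1 b)]
            rw [Finset.sum_congr rfl this, ← Finset.sum_mul]
        _ = S ^ 2 * (Fintype.card R * t) := by ring
        _ ≤ (t * P) ^ 2 * (Fintype.card R * t) := by gcongr
        _ = _ := by ring
    exact le_of_mul_le_mul_left h3 (by positivity)

/-- The main abstract inequality. -/
lemma abstract_bound {R : Type*} [CommRing R] [Fintype R] (ψ : AddChar R ℂ) (hψ : ψ.IsPrimitive)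
    (u : R) (t : ℕ) (ht : t = orderOf u) (ht0 : 0 < t) (huu : IsUnit u)
    (ζ : ℂ) (hζ : IsPrimitiveRoot ζ t)
    (χ : R → ℂ) (w : R → ℂ) (hχ : ∀ x, χ x = ∑ c, w c * ψ (c * x))
    (hw0 : ∀ c, ¬ IsUnit c → w c = 0) (hw : ∀ c, ‖w c‖ ≤ (√(Fintype.card R))⁻¹)
    (m : ℕ) (a : Fin (m + 2) → R) (ha : ∀ i, IsUnit (a i)) (L : Fin (m + 2) → ℕ)
    (P : Fin (m + 2) → ℝ) (hP0 : ∀ i, 0 ≤ P i)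
    (hP : ∀ i, ∑ b ∈ range t, ‖∑ k ∈ range (L i), (ζ ^ b)⁻¹ ^ k‖ ≤ t * P i) :
    ‖∑ k : (i : Fin (m + 2)) → Fin (L i), χ (∑ i, a i * u ^ (k i : ℕ))‖ ≤
      t * √(Fintype.card R) ^ (m + 1) * ∏ i, P i := by
  classical
  set q := √(Fintype.card R : ℝ) with hq
  have hqpos : 0 < q := Real.sqrt_pos.mpr (by exact_mod_cast Fintype.card_pos)
  have hqq : q ^ 2 = Fintype.card R := Real.sq_sqrt (by positivity)
  let I : Fin (m + 2) → R → ℂ := fun i c => ∑ k ∈ range (L i), ψ (c * a i * u ^ k)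
  have hI1 : ∀ i c, IsUnit c → ‖I i c‖ ≤ q * P i := fun i c hc =>
    (incomplete ψ hψ u t ht ht0 huu ζ hζ (L i) (P i) (hP i)).1 _ (hc.mul (ha i))
  have hI2 : ∀ i, ∑ c, ‖I i c‖ ^ 2 ≤ q ^ 2 * t * P i ^ 2 := by
    intro i
    have := (incomplete ψ hψ u t ht ht0 huu ζ hζ (L i) (P i) (hP i)).2
    rw [hqq]
    refine le_trans (le_of_eq ?_) this
    exact Fintype.sum_bijective (fun c => c * a i) (ha i).unit.mulRight_bijective _ _ fun c => rfl
  have hexp : ∑ k : (i : Fin (m + 2)) → Fin (L i), χ (∑ i, a i * u ^ (k i : ℕ)) =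
      ∑ c, w c * ∏ i, I i c := by
    simp_rw [hχ]
    rw [Finset.sum_comm]
    refine Finset.sum_congr rfl fun c _ => ?_
    rw [← Finset.mul_sum]
    congr 1
    simp only [I]
    simp_rw [← Fin.sum_univ_eq_sum_range]
    rw [Fintype.prod_sum]
    refine Finset.sum_congr rfl fun k _ => ?_
    rw [Finset.mul_sum, addChar_map_sum]
    simp_rw [mul_assoc]
  rw [hexp]
  set Q := ∏ i : Fin m, P i.succ.succ with hQ
  have hQ0 : 0 ≤ Q := Finset.prod_nonneg fun i _ => hP0 _
  have hterm : ∀ c, ‖w c * ∏ i, I i c‖ ≤ q⁻¹ * (q ^ m * Q) * (‖I 0 c‖ * ‖I 1 c‖) := by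
    intro c
    by_cases hc : IsUnit c
    · rw [norm_mul, norm_prod, Fin.prod_univ_succ, Fin.prod_univ_succ]
      have : ∏ i : Fin m, ‖I i.succ.succ c‖ ≤ q ^ m * Q := by
        calc _ ≤ ∏ i : Fin m, (q * P i.succ.succ) :=
              Finset.prod_le_prod (fun _ _ => norm_nonneg _) fun i _ => hI1 _ c hc
          _ = _ := by rw [Finset.prod_mul_distrib]; simp [hQ]
      calc _ ≤ q⁻¹ * (‖I 0 c‖ * (‖I 1 c‖ * (q ^ m * Q))) := by
            gcongr
            · exact hw c
            · simp
        _ = _ := by ring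
    · rw [hw0 c hc]; simp; positivity
  have hCS : ∑ c, ‖I 0 c‖ * ‖I 1 c‖ ≤ q ^ 2 * t * (P 0 * P 1) := by
    have h := Finset.sum_mul_sq_le_sq_mul_sq univ (fun c => ‖I 0 c‖) (fun c => ‖I 1 c‖)
    have h0 := hP0 0
    have h1 := hP0 1
    refine (sq_le_sq₀ (Finset.sum_nonneg fun _ _ => by positivity) (by positivity)).mp ?_
    refine h.trans ?_
    calc _ ≤ (q ^ 2 * t * P 0 ^ 2) * (q ^ 2 * t * P 1 ^ 2) :=
          mul_le_mul (hI2 0) (hI2 1) (by positivity) (by positivity)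
      _ = _ := by ring
  calc _ ≤ ∑ c, ‖w c * ∏ i, I i c‖ := norm_sum_le _ _
    _ ≤ ∑ c, q⁻¹ * (q ^ m * Q) * (‖I 0 c‖ * ‖I 1 c‖) := Finset.sum_le_sum fun c _ => hterm c
    _ = q⁻¹ * (q ^ m * Q) * ∑ c, ‖I 0 c‖ * ‖I 1 c‖ := by rw [Finset.mul_sum]
    _ ≤ q⁻¹ * (q ^ m * Q) * (q ^ 2 * t * (P 0 * P 1)) := by gcongr
    _ = _ := by
      rw [Fin.prod_univ_succ, Fin.prod_univ_succ]
      field_simp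
      rw [hQ]
      simp
      ring

lemma geom_norm_le (z : ℂ) (hz : ‖z‖ = 1) (L : ℕ) (d : ℝ) (hd : 0 < d) (h : d ≤ ‖z - 1‖) :
    ‖∑ k ∈ range L, z⁻¹ ^ k‖ ≤ 2 / d := by
  have hz0 : z ≠ 0 := by rintro rfl; simp at hz
  have e : z⁻¹ - 1 = - (z⁻¹ * (z - 1)) := by field_simp; ring
  have hn : ‖z⁻¹ - 1‖ = ‖z - 1‖ := by rw [e, norm_neg, norm_mul, norm_inv, hz]; simp
  have hne : z⁻¹ ≠ 1 := by
    intro h1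
    rw [h1, sub_self, norm_zero] at hn
    linarith
  rw [geom_sum_eq hne, norm_div, hn]
  have : ‖z⁻¹ ^ L - 1‖ ≤ 2 := by
    refine (norm_sub_le _ _).trans ?_
    simp [hz]; norm_num
  gcongr

lemma zeta_lower (n : ℕ) (b : ℕ) (hb : b ≤ n) :
    4 * (b : ℝ) / (2 * n + 1 : ℕ) ≤
      ‖(Complex.exp (2 * Real.pi * Complex.I / (2 * n + 1 : ℕ))) ^ b - 1‖ := by
  have htp : (0:ℝ) < (2 * n + 1 : ℕ) := by positivity
  have e : (Complex.exp (2 * Real.pi * Complex.I / (2 * n + 1 : ℕ))) ^ b =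
      Complex.exp (Complex.I * ((2 * Real.pi * b / (2 * n + 1 : ℕ) : ℝ) : ℂ)) := by
    rw [← Complex.exp_nat_mul]
    congr 1
    push_cast
    ring
  rw [e, Complex.norm_exp_I_mul_ofReal_sub_one]
  have h2 : 2 * Real.pi * b / (2 * n + 1 : ℕ) / 2 = Real.pi * (b / (2 * n + 1 : ℕ)) := by ring
  rw [h2]
  have hb2 : (b : ℝ) / (2 * n + 1 : ℕ) ≤ 1 / 2 := by
    rw [div_le_div_iff₀ htp (by norm_num)]
    have : (b : ℝ) ≤ n := by exact_mod_cast hb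
    push_cast
    linarith
  have := Real.mul_le_sin (x := Real.pi * (b / (2 * n + 1 : ℕ))) (by positivity)
    (by nlinarith [Real.pi_pos])
  have h3 : 2 / Real.pi * (Real.pi * (b / (2 * n + 1 : ℕ))) = 2 * b / (2 * n + 1 : ℕ) := by
    field_simp
  rw [h3] at this
  rw [Real.norm_eq_abs, abs_mul, abs_two]
  calc 4 * (b : ℝ) / (2 * n + 1 : ℕ) = 2 * (2 * b / (2 * n + 1 : ℕ)) := by ring
    _ ≤ _ := by gcongr; exact this.trans (le_abs_self _)

lemma dirichlet_sum (n L : ℕ) :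
    ∑ b ∈ range (2 * n + 1), ‖∑ k ∈ range L,
      ((Complex.exp (2 * Real.pi * Complex.I / (2 * n + 1 : ℕ))) ^ b)⁻¹ ^ k‖ ≤
      L + (2 * n + 1 : ℕ) * ((harmonic n : ℚ) : ℝ) := by
  have hζ := Complex.isPrimitiveRoot_exp (2 * n + 1) (by omega)
  have hlow := zeta_lower n
  set ζ := Complex.exp (2 * Real.pi * Complex.I / (2 * n + 1 : ℕ)) with hζd
  have hζ1 : ‖ζ‖ = 1 := hζ.norm'_eq_one (by omega)
  have hζ0 : ζ ≠ 0 := hζ.ne_zero (by omega)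
  have htp : (0:ℝ) < (2 * n + 1 : ℕ) := by positivity
  have hA : ∀ j ∈ range n, ‖∑ k ∈ range L, (ζ ^ (j + 1))⁻¹ ^ k‖ ≤
      (2 * n + 1 : ℕ) / 2 * ((j + 1 : ℕ) : ℝ)⁻¹ := by
    intro j hj
    have := geom_norm_le (ζ ^ (j + 1)) (by simp [hζ1]) L _ (by positivity)
      (hlow (j + 1) (by simpa using hj))
    refine this.trans (le_of_eq ?_)
    field_simp
    norm_num
  have hB : ∀ j ∈ range n, ‖∑ k ∈ range L, (ζ ^ (n + (n - 1 - j) + 1))⁻¹ ^ k‖ ≤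
      (2 * n + 1 : ℕ) / 2 * ((j + 1 : ℕ) : ℝ)⁻¹ := by
    intro j hj
    have hj' : j < n := by simpa using hj
    have e1 : ζ ^ (n + (n - 1 - j) + 1) * ζ ^ (j + 1) = 1 := by
      rw [← pow_add]
      convert hζ.pow_eq_one using 2
      omega
    have e2 : ζ ^ (n + (n - 1 - j) + 1) - 1 = - (ζ ^ (n + (n - 1 - j) + 1) * (ζ ^ (j + 1) - 1)) := by
      rw [mul_sub, e1]; ring
    have e3 : ‖ζ ^ (n + (n - 1 - j) + 1) - 1‖ = ‖ζ ^ (j + 1) - 1‖ := by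
      rw [e2, norm_neg, norm_mul, norm_pow, hζ1]; simp
    have := geom_norm_le (ζ ^ (n + (n - 1 - j) + 1)) (by simp [hζ1]) L _ (by positivity)
      ((hlow (j + 1) (by simpa using hj)).trans e3.ge)
    refine this.trans (le_of_eq ?_)
    field_simp
    norm_num
  rw [Finset.sum_range_succ', two_mul, Finset.sum_range_add,
    ← Finset.sum_range_reflect (fun x => ‖∑ k ∈ range L, (ζ ^ (n + x + 1))⁻¹ ^ k‖)]
  have hH : ((harmonic n : ℚ) : ℝ) = ∑ j ∈ range n, ((j + 1 : ℕ) : ℝ)⁻¹ := by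
    simp [harmonic]
  have h0 : ‖∑ k ∈ range L, (ζ ^ 0)⁻¹ ^ k‖ = L := by simp
  have h1 := Finset.sum_le_sum hA
  have h2 := Finset.sum_le_sum hB
  rw [← Finset.mul_sum, ← hH] at h1 h2
  rw [h0]
  rw [← two_mul n]
  linarith

lemma harmonic_bound (n N : ℕ) (hN : 4 * (2 * n + 1) ≤ N) :
    ((harmonic n : ℚ) : ℝ) ≤ Real.log N - 1 ∧ 0 ≤ Real.log N - 1 := by
  have hl2 := Real.log_two_gt_d9
  have h4 : Real.log 4 = 2 * Real.log 2 := by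
    rw [show (4:ℝ) = 2 ^ 2 by norm_num, Real.log_pow]; norm_num
  have h8 : Real.log 8 = 3 * Real.log 2 := by
    rw [show (8:ℝ) = 2 ^ 3 by norm_num, Real.log_pow]; norm_num
  have hN4 : Real.log 4 ≤ Real.log N := Real.log_le_log (by norm_num) (by
    have : 4 ≤ N := by omega
    exact_mod_cast this)
  refine ⟨?_, by linarith⟩
  rcases Nat.eq_zero_or_pos n with rfl | hn
  · simp; linarith
  · have h := harmonic_le_one_add_log n
    have hn' : (0:ℝ) < n := by exact_mod_cast hn
    have : Real.log (8 * n) ≤ Real.log N := Real.log_le_log (by positivity) (by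
      have : 8 * n ≤ N := by omega
      exact_mod_cast this)
    rw [Real.log_mul (by norm_num) hn'.ne'] at this
    linarith

lemma prod_ineq {ι : Type*} (s : Finset ι) (x : ι → ℝ) (Λ Y : ℝ) (hΛ : 0 ≤ Λ) (hY : 1 ≤ Y)
    (hx0 : ∀ i, 0 ≤ x i) (hx : ∀ i, x i ≤ Y) :
    Y * (∏ i ∈ s, (x i + Λ)) ≤ Y * ∏ i ∈ s, x i + Y ^ s.card * ((1 + Λ) ^ s.card - 1) := by
  classical
  induction s using Finset.induction_on with
  | empty => simp
  | insert i s hi ih =>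
    rw [Finset.prod_insert hi, Finset.prod_insert hi, Finset.card_insert_of_notMem hi]
    have hA : ∏ i ∈ s, (x i + Λ) ≤ Y ^ s.card * (1 + Λ) ^ s.card := by
      rw [← mul_pow, ← Finset.prod_const]
      refine Finset.prod_le_prod (fun i _ => add_nonneg (hx0 i) hΛ) fun i _ => ?_
      nlinarith [hx i]
    have h1 := mul_le_mul_of_nonneg_left ih (hx0 i)
    have h2 := mul_le_mul_of_nonneg_left hA (mul_nonneg (zero_le_one.trans hY) hΛ)
    have hG : 0 ≤ (1 + Λ) ^ s.card - 1 := by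
      have := one_le_pow₀ (n := s.card) (show 1 ≤ 1 + Λ by linarith)
      linarith
    have h3 : x i * (Y ^ s.card * ((1 + Λ) ^ s.card - 1)) ≤ Y * (Y ^ s.card * ((1 + Λ) ^ s.card - 1)) :=
      mul_le_mul_of_nonneg_right (hx i) (mul_nonneg (by positivity) hG)
    rw [pow_succ, pow_succ]
    linarith

lemma prod_ineq2 (m : ℕ) (x : Fin (m + 1) → ℝ) (Λ X : ℝ) (hΛ : 0 ≤ Λ)
    (hx0 : ∀ i, 0 ≤ x i) (hx : ∀ i, x i ≤ X) :
    ∏ i, (x i + Λ) ≤ ∏ i, x i + (X ^ m + 1) * (1 + Λ) ^ (m + 1) := by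
  have hX0 : 0 ≤ X := (hx0 0).trans (hx 0)
  have h := prod_ineq univ x Λ (max X 1) hΛ (le_max_right _ _) hx0
    (fun i => (hx i).trans (le_max_left _ _))
  have hY : 0 < max X 1 := lt_max_of_lt_right one_pos
  have hYm : (max X 1) ^ m ≤ X ^ m + 1 := by
    rcases le_total X 1 with h1 | h1
    · rw [max_eq_right h1]; simp; positivity
    · rw [max_eq_left h1]; linarith
  simp only [card_univ, Fintype.card_fin] at h
  rw [pow_succ' (max X 1), mul_assoc, ← mul_add] at h
  refine (le_of_mul_le_mul_left h hY).trans ?_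
  have : 0 ≤ (1 + Λ) ^ (m + 1) := by positivity
  refine add_le_add le_rfl ?_
  calc (max X 1) ^ m * ((1 + Λ) ^ (m + 1) - 1) ≤ (max X 1) ^ m * (1 + Λ) ^ (m + 1) := by
        gcongr; linarith
    _ ≤ _ := by gcongr

lemma core {R : Type*} [CommRing R] [Fintype R] (ψ : AddChar R ℂ) (hψ : ψ.IsPrimitive)
    (u : R) (t : ℕ) (ht : t = orderOf u) (htodd : Odd t) (huu : IsUnit u) (N : ℕ)
    (hN : 4 * t ≤ N) (hR : Fintype.card R ≤ N)
    (χ : R → ℂ) (w : R → ℂ) (hχ : ∀ x, χ x = ∑ c, w c * ψ (c * x))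
    (hw0 : ∀ c, ¬ IsUnit c → w c = 0) (hw : ∀ c, ‖w c‖ ≤ (√(Fintype.card R))⁻¹)
    (m : ℕ) (a : Fin (m + 2) → R) (ha : ∀ i, IsUnit (a i)) (L : Fin (m + 2) → ℕ) :
    ‖∑ k : (i : Fin (m + 2)) → Fin (L i), χ (∑ i, a i * u ^ ((k i : ℕ) + 1))‖ ≤
      (∏ i, (L i : ℝ)) / (t : ℝ) ^ (m + 1) * (N : ℝ) ^ ((((m + 2 : ℕ) : ℝ) - 1) / 2)
            + (((Finset.univ.sup L : ℕ) : ℝ) ^ (m + 1) / (t : ℝ) ^ (m + 1) + 1) *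
              (N : ℝ) ^ ((((m + 2 : ℕ) : ℝ) + 1) / 2) * (Real.log (N : ℝ)) ^ (m + 2) := by
  obtain ⟨n, rfl⟩ := htodd
  set t := 2 * n + 1 with htn
  have ht0 : 0 < t := by omega
  have ht1 : (0:ℝ) < t := by exact_mod_cast ht0
  have hN0 : (0:ℝ) < N := by
    have : 0 < N := by omega
    exact_mod_cast this
  obtain ⟨hH, hΛ⟩ := harmonic_bound n N hN
  set Λ := Real.log N - 1 with hΛd
  have hb := abstract_bound ψ hψ u t ht ht0 huu _ (Complex.isPrimitiveRoot_exp t ht0.ne')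
    χ w hχ hw0 hw m (fun i => a i * u) (fun i => (ha i).mul huu) L
    (fun i => (L i : ℝ) / t + Λ) (fun i => by positivity) (fun i => by
      refine (dirichlet_sum n (L i)).trans ?_
      rw [mul_add, mul_div_cancel₀ _ ht1.ne']
      gcongr)
  have e : ∀ (i : Fin (m + 2)) (k : ℕ), a i * u ^ (k + 1) = a i * u * u ^ k := fun i k => by
    rw [pow_succ']; ring
  simp_rw [e]
  refine hb.trans ?_
  have hp := prod_ineq2 (m + 1) (fun i => (L i : ℝ) / t) Λ ((univ.sup L : ℕ) / t) hΛ
    (fun i => by positivity) (fun i => by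
      have : L i ≤ univ.sup L := Finset.le_sup (f := L) (mem_univ i)
      gcongr)
  have hlog : 1 + Λ = Real.log N := by rw [hΛd]; ring
  rw [hlog] at hp
  have hs1 : (N : ℝ) ^ ((((m + 2 : ℕ) : ℝ) - 1) / 2) = √(N:ℝ) ^ (m + 1) := by
    rw [Real.sqrt_eq_rpow, ← Real.rpow_mul_natCast hN0.le]
    congr 1; push_cast; ring
  have hs2 : (N : ℝ) ^ ((((m + 2 : ℕ) : ℝ) + 1) / 2) = N * √(N:ℝ) ^ (m + 1) := by
    rw [← hs1, ← Real.rpow_one_add' hN0.le]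
    · congr 1; push_cast; ring
    · push_cast
      have : (0:ℝ) ≤ m := by positivity
      linarith
  rw [hs1, hs2]
  have hlog0 : 0 ≤ Real.log N := by linarith
  have hprod : ∏ i, ((L i : ℝ) / t) = (∏ i, (L i : ℝ)) / t ^ (m + 2) := by
    rw [Finset.prod_div_distrib]; simp
  rw [hprod, div_pow] at hp
  have hpn : 0 ≤ ∏ i, ((L i : ℝ) / t + Λ) := Finset.prod_nonneg fun i _ => by positivity
  have htN : (t:ℝ) ≤ N := by
    have : t ≤ N := by omega
    exact_mod_cast this
  calc _ ≤ t * √(N:ℝ) ^ (m + 1) * ∏ i, ((L i : ℝ) / t + Λ) := by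
        gcongr
    _ ≤ t * √(N:ℝ) ^ (m + 1) * ((∏ i, (L i : ℝ)) / t ^ (m + 2) +
        (((univ.sup L : ℕ) : ℝ) ^ (m + 1) / t ^ (m + 1) + 1) * Real.log N ^ (m + 1 + 1)) := by
        gcongr
    _ = (∏ i, (L i : ℝ)) / t ^ (m + 1) * √(N:ℝ) ^ (m + 1) +
        (((univ.sup L : ℕ) : ℝ) ^ (m + 1) / t ^ (m + 1) + 1) * (t * √(N:ℝ) ^ (m + 1)) *
          Real.log N ^ (m + 2) := by
        rw [mul_add]
        congr 1
        · rw [pow_succ (t:ℝ) (m + 1)]; field_simp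
        · ring
    _ ≤ _ := by gcongr

lemma prime_exp (p : ℕ) [Fact p.Prime] (hp : p ≠ 2) :
    ∃ (ψ : AddChar (ZMod p) ℂ) (w : ZMod p → ℂ), ψ.IsPrimitive ∧
      (∀ x, ((quadraticChar (ZMod p) x : ℤ) : ℂ) = ∑ c, w c * ψ (c * x)) ∧
      (∀ c, ¬ IsUnit c → w c = 0) ∧ (∀ c, ‖w c‖ ≤ (√(Fintype.card (ZMod p)))⁻¹) := by
  have hψ := ZMod.isPrimitive_stdAddChar p
  set ψ : AddChar (ZMod p) ℂ := ZMod.stdAddChar with hψd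
  set χ : MulChar (ZMod p) ℂ := (quadraticChar (ZMod p)).ringHomComp (Int.castRingHom ℂ) with hχd
  have hχ2 : χ.IsQuadratic := (quadraticChar_isQuadratic (ZMod p)).comp _
  have hχ1 : χ ≠ 1 := by
    have := quadraticChar_ne_one (F := ZMod p) (by rwa [ZMod.ringChar_zmod_n])
    exact (MulChar.ringHomComp_ne_one_iff (RingHom.injective_int _)).mpr this
  have hsq := gaussSum_sq hχ1 hχ2 hψ
  have hn1 : ‖χ (-1)‖ = 1 := by
    have : χ (-1) * χ (-1) = 1 := by rw [← map_mul]; simp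
    have := congrArg norm this
    rw [norm_mul, norm_one] at this
    nlinarith [norm_nonneg (χ (-1))]
  have hle : ∀ c, ‖χ c‖ ≤ 1 := by
    intro c
    rcases hχ2 c with h | h | h <;> simp [h]
  have hG : ‖gaussSum χ ψ‖ = √(Fintype.card (ZMod p)) := by
    have := congrArg norm hsq
    rw [norm_pow, norm_mul, hn1, one_mul, Complex.norm_natCast] at this
    rw [← this, Real.sqrt_sq (norm_nonneg _)]
  have hcard : (0:ℝ) < √(Fintype.card (ZMod p)) :=
    Real.sqrt_pos.mpr (by exact_mod_cast Fintype.card_pos)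
  have hG0 : gaussSum χ ψ ≠ 0 := by
    intro h; rw [h, norm_zero] at hG; linarith
  refine ⟨ψ, fun c => χ c / gaussSum χ ψ, hψ, ?_, ?_, ?_⟩
  · intro x
    have hx : χ x * gaussSum χ ψ = ∑ c, χ c * ψ (c * x) := by
      by_cases h0 : x = 0
      · subst h0
        have h00 : χ 0 = 0 := χ.map_nonunit (by simp)
        simp [MulChar.sum_eq_zero_of_ne_one hχ1, h00]
      · have := gaussSum_mulShift_eq χ ψ (Units.mk0 x h0)
        rw [hχ2.inv, gaussSum] at this
        rw [Units.val_mk0] at this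
        rw [← this]
        simp [AddChar.mulShift_apply, mul_comm]
    calc ((quadraticChar (ZMod p) x : ℤ) : ℂ) = χ x := by simp [hχd]
      _ = χ x * gaussSum χ ψ / gaussSum χ ψ := by field_simp
      _ = _ := by rw [hx, Finset.sum_div]; exact Finset.sum_congr rfl fun c _ => by ring
  · intro c hc
    simp [χ.map_nonunit hc]
  · intro c
    rw [norm_div, hG, div_eq_mul_inv]
    exact mul_le_of_le_one_left (by positivity) (hle c)

lemma prod_exp {A B : Type*} [CommRing A] [CommRing B] [Fintype A] [Fintype B]
    (ψ₁ : AddChar A ℂ) (w₁ χ₁ : A → ℂ) (h₁ : ψ₁.IsPrimitive)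
    (e₁ : ∀ x, χ₁ x = ∑ c, w₁ c * ψ₁ (c * x))
    (z₁ : ∀ c, ¬ IsUnit c → w₁ c = 0) (n₁ : ∀ c, ‖w₁ c‖ ≤ (√(Fintype.card A))⁻¹)
    (ψ₂ : AddChar B ℂ) (w₂ χ₂ : B → ℂ) (h₂ : ψ₂.IsPrimitive)
    (e₂ : ∀ x, χ₂ x = ∑ c, w₂ c * ψ₂ (c * x))
    (z₂ : ∀ c, ¬ IsUnit c → w₂ c = 0) (n₂ : ∀ c, ‖w₂ c‖ ≤ (√(Fintype.card B))⁻¹) :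
    ∃ (ψ : AddChar (A × B) ℂ) (w : A × B → ℂ), ψ.IsPrimitive ∧
      (∀ x : A × B, χ₁ x.1 * χ₂ x.2 = ∑ c, w c * ψ (c * x)) ∧
      (∀ c, ¬ IsUnit c → w c = 0) ∧ (∀ c, ‖w c‖ ≤ (√(Fintype.card (A × B)))⁻¹) := by
  let ψ : AddChar (A × B) ℂ :=
    { toFun := fun x => ψ₁ x.1 * ψ₂ x.2
      map_zero_eq_one' := by simp
      map_add_eq_mul' := by
        intro x y
        simp only [Prod.fst_add, Prod.snd_add, AddChar.map_add_eq_mul]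
        ring }
  have hψ : ∀ x : A × B, ψ x = ψ₁ x.1 * ψ₂ x.2 := fun x => rfl
  refine ⟨ψ, fun c => w₁ c.1 * w₂ c.2, ?_, ?_, ?_, ?_⟩
  · rintro ⟨a, b⟩ hab h
    have hh : ∀ x : A × B, ψ ((a, b) * x) = 1 := by
      intro x
      have := DFunLike.congr_fun h x
      simpa [AddChar.mulShift_apply] using this
    have ha : a = 0 := by
      by_contra ha
      apply h₁ ha
      ext x
      have := hh (x, 0)
      simpa [hψ, AddChar.mulShift_apply] using this
    have hb : b = 0 := by
      by_contra hb
      apply h₂ hb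
      ext x
      have := hh (0, x)
      simpa [hψ, AddChar.mulShift_apply] using this
    apply hab
    rw [ha, hb]; rfl
  · intro x
    rw [e₁, e₂, Finset.sum_mul_sum, Fintype.sum_prod_type]
    refine Finset.sum_congr rfl fun c _ => Finset.sum_congr rfl fun d _ => ?_
    simp only [hψ, Prod.fst_mul, Prod.snd_mul]
    ring
  · rintro ⟨c, d⟩ h
    rw [Prod.isUnit_iff, not_and_or] at h
    rcases h with h | h
    · simp [z₁ c h]
    · simp [z₂ d h]
  · rintro ⟨c, d⟩
    rw [Fintype.card_prod, Nat.cast_mul, Real.sqrt_mul (by positivity), mul_inv, norm_mul]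
    exact mul_le_mul (n₁ c) (n₂ d) (norm_nonneg _) (by positivity)

lemma zmod_two_eq_one : ∀ y : ZMod 2, y ≠ 0 → y = 1 := by decide

lemma jacobi_abs_le (x : ℤ) (n : ℕ) : |((jacobiSym x n : ℤ) : ℝ)| ≤ 1 := by
  rcases jacobiSym.trichotomy x n with h | h | h <;> simp [h]

lemma jacobi_prime (p : ℕ) [Fact p.Prime] (x : ℤ) :
    jacobiSym x p = quadraticChar (ZMod p) (x : ZMod p) := by
  rw [← jacobiSym.legendreSym.to_jacobiSym]; rfl

lemma order_bound (p : ℕ) [Fact p.Prime] (hp : p ≠ 2) (θ : ZMod p) (hθ : θ ≠ 0)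
    (hodd : Odd (orderOf θ)) : 2 * orderOf θ ≤ p - 1 := by
  have hpp : p.Prime := Fact.out
  have h1 : orderOf θ ∣ p - 1 := orderOf_dvd_of_pow_eq_one (ZMod.pow_card_sub_one_eq_one hθ)
  have h2 : 2 ∣ p - 1 := (hpp.even_sub_one hp).two_dvd
  have h3 : Nat.Coprime 2 (orderOf θ) := (Nat.coprime_two_left).mpr hodd
  exact Nat.le_of_dvd (by have := hpp.two_le; omega) (h3.mul_dvd_of_dvd_of_dvd h2 h1)

lemma unit_of_coprime (p q : ℕ) [Fact p.Prime] (hq : p ∣ q) (b c : ℤ)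
    (h : IsCoprime (q : ℤ) c) (hb : b ∣ c) : IsUnit (b : ZMod p) := by
  rw [isUnit_iff_ne_zero, Ne, ZMod.intCast_zmod_eq_zero_iff_dvd]
  intro hpb
  have hq' : (p : ℤ) ∣ q := by exact_mod_cast hq
  have hu := h.isUnit_of_dvd' hq' (hpb.trans hb)
  have hp : p.Prime := Fact.out
  exact (Nat.prime_iff_prime_int.mp hp).not_isUnit hu

lemma order_prod (ℓ r θ : ℕ) (h : Nat.Coprime ℓ r)
    (hc : Nat.Coprime (orderOf (θ : ZMod ℓ)) (orderOf (θ : ZMod r))) :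
    orderOf (θ : ZMod (ℓ * r)) = orderOf (((θ : ZMod ℓ), (θ : ZMod r)) : ZMod ℓ × ZMod r) ∧
    orderOf (θ : ZMod (ℓ * r)) = orderOf (θ : ZMod ℓ) * orderOf (θ : ZMod r) := by
  have h1 : orderOf (θ : ZMod (ℓ * r)) =
      orderOf (((θ : ZMod ℓ), (θ : ZMod r)) : ZMod ℓ × ZMod r) := by
    have := orderOf_injective (ZMod.chineseRemainder h : ZMod (ℓ * r) →* ZMod ℓ × ZMod r)
      (ZMod.chineseRemainder h).injective (θ : ZMod (ℓ * r))
    rw [← this]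
    congr 1
    simp
    rfl
  refine ⟨h1, ?_⟩
  rw [h1, Prod.orderOf_mk, hc.lcm_eq_mul]

lemma main_lt (m : ℕ) (θ : ℕ) (a : Fin (m + 2) → ℤ) (ℓ r : ℕ) (hℓ : ℓ.Prime) (hr : r.Prime)
    (hlt : ℓ < r)
    (hco : IsCoprime ((ℓ * r : ℕ) : ℤ) ((θ : ℤ) * ∏ i, a i))
    (hcop : Nat.Coprime (orderOf (θ : ZMod ℓ)) (orderOf (θ : ZMod r)))
    (ho1 : Odd (orderOf (θ : ZMod ℓ))) (ho2 : Odd (orderOf (θ : ZMod r)))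
    (L : Fin (m + 2) → ℕ) :
    |(∑ k : (i : Fin (m + 2)) → Fin (L i),
          (jacobiSym (∑ i, a i * (θ : ℤ) ^ ((k i : ℕ) + 1)) (ℓ * r) : ℝ))| ≤
      (∏ i, (L i : ℝ)) / (orderOf (θ : ZMod (ℓ * r)) : ℝ) ^ (m + 1) *
              ((ℓ * r : ℕ) : ℝ) ^ ((((m + 2 : ℕ) : ℝ) - 1) / 2)
            + (((Finset.univ.sup L : ℕ) : ℝ) ^ (m + 1) /
                  (orderOf (θ : ZMod (ℓ * r)) : ℝ) ^ (m + 1) + 1) *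
              ((ℓ * r : ℕ) : ℝ) ^ ((((m + 2 : ℕ) : ℝ) + 1) / 2) *
              (Real.log ((ℓ * r : ℕ) : ℝ)) ^ (m + 2) := by
  have : Fact ℓ.Prime := ⟨hℓ⟩
  have : Fact r.Prime := ⟨hr⟩
  have hℓ2 := hℓ.two_le
  have hr2 : r ≠ 2 := by omega
  have hℓr : Nat.Coprime ℓ r := (Nat.coprime_primes hℓ hr).mpr hlt.ne
  have hai : ∀ i, a i ∣ (θ : ℤ) * ∏ i, a i := fun i =>
    (Finset.dvd_prod_of_mem a (mem_univ i)).mul_left _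
  have uaℓ : ∀ i, IsUnit (a i : ZMod ℓ) := fun i =>
    unit_of_coprime ℓ (ℓ * r) (dvd_mul_right _ _) _ _ hco (hai i)
  have uar : ∀ i, IsUnit (a i : ZMod r) := fun i =>
    unit_of_coprime r (ℓ * r) (dvd_mul_left _ _) _ _ hco (hai i)
  have uθℓ : IsUnit (θ : ZMod ℓ) := by
    have := unit_of_coprime ℓ (ℓ * r) (dvd_mul_right _ _) θ _ hco (dvd_mul_right _ _)
    simpa using this
  have uθr : IsUnit (θ : ZMod r) := by
    have := unit_of_coprime r (ℓ * r) (dvd_mul_left _ _) θ _ hco (dvd_mul_right _ _)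
    simpa using this
  obtain ⟨hord1, hord2⟩ := order_prod ℓ r θ hℓr hcop
  have hbr := order_bound r hr2 (θ : ZMod r) uθr.ne_zero ho2
  have hoddt : Odd (orderOf (θ : ZMod (ℓ * r))) := by rw [hord2]; exact ho1.mul ho2
  obtain ⟨ψ₂, w₂, h₂, e₂, z₂, n₂⟩ := prime_exp r hr2
  have hmul : ∀ x : ℤ, jacobiSym x (ℓ * r) = jacobiSym x ℓ * jacobiSym x r := fun x =>
    jacobiSym.mul_right x ℓ r
  by_cases h2 : ℓ = 2
  · subst h2
    have ht1 : orderOf (θ : ZMod 2) = 1 := by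
      have : (θ : ZMod 2) = 1 := zmod_two_eq_one _ uθℓ.ne_zero
      rw [this, orderOf_one]
    have hord : orderOf (θ : ZMod (2 * r)) = orderOf (θ : ZMod r) := by rw [hord2, ht1, one_mul]
    have hc := core ψ₂ h₂ (θ : ZMod r) (orderOf (θ : ZMod (2 * r))) hord hoddt uθr (2 * r)
      (by rw [hord]; omega) (by rw [ZMod.card]; omega) _ w₂ e₂ z₂ n₂ m
      (fun i => (a i : ZMod r)) uar L
    refine le_trans ?_ hc
    set ε : ℤ := quadraticChar (ZMod 2) ((m + 2 : ℕ) : ZMod 2) with hε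
    have hpar : ∀ k : (i : Fin (m + 2)) → Fin (L i),
        jacobiSym (∑ i, a i * (θ : ℤ) ^ ((k i : ℕ) + 1)) 2 = ε := by
      intro k
      rw [jacobi_prime, hε]
      congr 1
      have hone : ∀ y : ZMod 2, IsUnit y → y = 1 := fun y hy => zmod_two_eq_one y hy.ne_zero
      push_cast
      simp only [hone _ (uaℓ _), hone _ uθℓ]
      simp
    have hεle : |(ε : ℝ)| ≤ 1 := by
      have := jacobi_abs_le ((m + 2 : ℕ) : ℤ) 2
      rw [jacobi_prime] at this
      simpa [hε] using this
    have e : ∑ k : (i : Fin (m + 2)) → Fin (L i),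
          (jacobiSym (∑ i, a i * (θ : ℤ) ^ ((k i : ℕ) + 1)) (2 * r) : ℝ) =
        ε * ∑ k : (i : Fin (m + 2)) → Fin (L i),
          ((quadraticChar (ZMod r) (∑ i, (a i : ZMod r) * (θ : ZMod r) ^ ((k i : ℕ) + 1)) : ℤ) : ℝ) := by
      rw [Finset.mul_sum]
      refine Finset.sum_congr rfl fun k _ => ?_
      rw [hmul, hpar, jacobi_prime]
      push_cast
      rfl
    rw [e, abs_mul, ← Real.norm_eq_abs (∑ k : (i : Fin (m + 2)) → Fin (L i), _),
      ← Complex.norm_real]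
    push_cast
    exact mul_le_of_le_one_left (norm_nonneg _) hεle
  · obtain ⟨ψ₁, w₁, h₁, e₁, z₁, n₁⟩ := prime_exp ℓ h2
    have hbℓ := order_bound ℓ h2 (θ : ZMod ℓ) uθℓ.ne_zero ho1
    obtain ⟨ψ, w, h, e, z, n⟩ := prod_exp ψ₁ w₁ _ h₁ e₁ z₁ n₁ ψ₂ w₂ _ h₂ e₂ z₂ n₂
    have hc := core ψ h ((θ : ZMod ℓ), (θ : ZMod r)) (orderOf (θ : ZMod (ℓ * r))) hord1 hoddt
      (Prod.isUnit_iff.mpr ⟨uθℓ, uθr⟩) (ℓ * r)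
      (by
        rw [hord2]
        calc 4 * (orderOf (θ : ZMod ℓ) * orderOf (θ : ZMod r)) =
            (2 * orderOf (θ : ZMod ℓ)) * (2 * orderOf (θ : ZMod r)) := by ring
          _ ≤ (ℓ - 1) * (r - 1) := Nat.mul_le_mul hbℓ hbr
          _ ≤ ℓ * r := Nat.mul_le_mul (Nat.sub_le _ _) (Nat.sub_le _ _))
      (by rw [Fintype.card_prod, ZMod.card, ZMod.card]) _ w e z n m
      (fun i => ((a i : ZMod ℓ), (a i : ZMod r)))
      (fun i => Prod.isUnit_iff.mpr ⟨uaℓ i, uar i⟩) L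
    refine le_trans (le_of_eq ?_) hc
    rw [← Real.norm_eq_abs, ← Complex.norm_real]
    congr 1
    push_cast
    refine Finset.sum_congr rfl fun k _ => ?_
    rw [hmul, jacobi_prime, jacobi_prime]
    push_cast
    simp [Prod.fst_sum, Prod.snd_sum]


/-- Incomplete Jacobi-symbol sums with exponential-function arguments,
with an absolute implied constant. -/
theorem stmt15 :
    ∃ C : ℝ, 0 < C ∧ ∀ (m : ℕ), 1 ≤ m → ∀ (θ : ℕ), 2 ≤ θ →
      ∀ (a : Fin m → ℤ) (ℓ r : ℕ), ℓ.Prime → r.Prime → ℓ ≠ r →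
      IsCoprime ((ℓ * r : ℕ) : ℤ) ((θ : ℤ) * ∏ i, a i) →
      Nat.Coprime (orderOf (θ : ZMod ℓ)) (orderOf (θ : ZMod r)) →
      Odd (orderOf (θ : ZMod ℓ)) → Odd (orderOf (θ : ZMod r)) →
      ∀ L : Fin m → ℕ, (∀ i, 1 ≤ L i) →
      |(∑ k : (i : Fin m) → Fin (L i),
          (jacobiSym (∑ i, a i * (θ : ℤ) ^ ((k i : ℕ) + 1)) (ℓ * r) : ℝ))|
        ≤ C * ((∏ i, (L i : ℝ)) / (orderOf (θ : ZMod (ℓ * r)) : ℝ) ^ (m - 1) *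
              ((ℓ * r : ℕ) : ℝ) ^ (((m : ℝ) - 1) / 2)
            + (((Finset.univ.sup L : ℕ) : ℝ) ^ (m - 1) /
                  (orderOf (θ : ZMod (ℓ * r)) : ℝ) ^ (m - 1) + 1) *
              ((ℓ * r : ℕ) : ℝ) ^ (((m : ℝ) + 1) / 2) *
              (Real.log ((ℓ * r : ℕ) : ℝ)) ^ m) := by
  refine ⟨1, one_pos, ?_⟩
  intro m hm θ hθ a ℓ r hℓ hr hne hco hcop ho1 ho2 L hL
  rw [one_mul]
  rcases m with _ | _ | m
  · omega
  · have hN : (1:ℝ) ≤ ((ℓ * r : ℕ) : ℝ) := by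
      exact_mod_cast Nat.mul_pos hℓ.pos hr.pos
    have hlog := Real.log_nonneg hN
    have h1 : |(∑ k : (i : Fin (0 + 1)) → Fin (L i),
        (jacobiSym (∑ i, a i * (θ : ℤ) ^ ((k i : ℕ) + 1)) (ℓ * r) : ℝ))| ≤ ∏ i, (L i : ℝ) := by
      refine (Finset.abs_sum_le_sum_abs _ _).trans ?_
      refine (Finset.sum_le_sum fun k _ => jacobi_abs_le _ _).trans ?_
      simp
    refine h1.trans ?_
    have h2 : (∏ i, (L i : ℝ)) / (orderOf (θ : ZMod (ℓ * r)) : ℝ) ^ (0 + 1 - 1) *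
              ((ℓ * r : ℕ) : ℝ) ^ ((((0 + 1 : ℕ) : ℝ) - 1) / 2) = ∏ i, (L i : ℝ) := by
      simp
    rw [h2]
    refine le_add_of_nonneg_right ?_
    positivity
  · rcases lt_or_gt_of_ne hne with h | h
    · exact main_lt m θ a ℓ r hℓ hr h hco hcop ho1 ho2 L
    · have := main_lt m θ a r ℓ hr hℓ h (by rwa [mul_comm r ℓ]) hcop.symm ho2 ho1 L
      rw [mul_comm r ℓ] at this
      exact this
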